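/- arXiv:2508.11174 — 4 statements merged into one kernel-verified Lean document; each statement's English description precedes it below -/
import Mathlib

section
/- Suppose n ≥ 2, T is stable under the involution * (i.e. σ ∈ T if and only if σ* ∈ T), and σ₁ ∈ T. Then a₁ = 1/2 − 1/f, a_j = 1/2 for every 1 < j < n, and a_n = 1/2 + 1/f; that is, the μ-ordinary slopes attached to T are 1/2 − 1/f with multiplicity f, 1/2 with multiplicity (n−2)f, and 1/2 + 1/f with multiplicity f. -/
/-- The composite `σ* = conj ∘ σ` of a complex embedding with complex conjugation. -/
def conjEmb {F : Type*} [Field F] (σ : F →+* ℂ) : F →+* ℂ :=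
  (starRingEnd ℂ).comp σ

@[simp]
theorem conjEmb_conjEmb {F : Type*} [Field F] (σ : F →+* ℂ) : conjEmb (conjEmb σ) = σ := by
  ext x
  simp [conjEmb]

/-- A finite set of complex embeddings stable under conjugation has exactly half of its elements
outside a given CM type. -/
theorem two_mul_card_filter_notMem_cmType {F : Type*} [Field F] [DecidableEq (F →+* ℂ)]
    {Φ T : Finset (F →+* ℂ)} (hΦ : ∀ σ : F →+* ℂ, conjEmb σ ∈ Φ ↔ σ ∉ Φ)
    (hT : ∀ σ : F →+* ℂ, σ ∈ T ↔ conjEmb σ ∈ T) :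
    2 * (T.filter (· ∉ Φ)).card = T.card := by
  have hcard : (T.filter (· ∈ Φ)).card = (T.filter (· ∉ Φ)).card := by
    refine Finset.card_nbij' conjEmb conjEmb ?_ ?_ (fun σ _ => conjEmb_conjEmb σ)
      (fun σ _ => conjEmb_conjEmb σ)
    all_goals
      intro σ hσ
      simpa [hΦ, ← hT] using hσ
  have hsum := Finset.card_filter_add_card_filter_not (s := T) (· ∈ Φ)
  lia

/-- Let `F` be a totally complex number field, `Φ` a CM type of `F`,
`σ₁ ∈ Φ`, `n ≥ 2`, and let `𝔣` be the simple signature.  Let `T` be a nonempty finite set of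
complex embeddings of `F` of cardinality `f`, stable under `σ ↦ σ*`, with `σ₁ ∈ T`.  Then
the μ-ordinary slopes `a_j = #{σ ∈ T : 𝔣(σ) > n − j} / f` attached to `T` satisfy
`a₁ = 1/2 − 1/f`, `a_j = 1/2` for `1 < j < n`, and `a_n = 1/2 + 1/f`; i.e. the slopes are
`1/2 − 1/f` with multiplicity `f`, `1/2` with multiplicity `(n−2)f`, and `1/2 + 1/f` with
multiplicity `f`. -/
theorem stmt_2 (F : Type*) [Field F] [NumberField F]
    (htc : ∀ σ : F →+* ℂ, conjEmb σ ≠ σ)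
    (Φ : Finset (F →+* ℂ))
    (hΦ : ∀ σ : F →+* ℂ, Xor' (σ ∈ Φ) (conjEmb σ ∈ Φ))
    (σ₁ : F →+* ℂ) (hσ₁ : σ₁ ∈ Φ)
    (n : ℕ) (hn : 2 ≤ n)
    (𝔣 : (F →+* ℂ) → ℤ)
    (h𝔣σ₁ : 𝔣 σ₁ = 1)
    (h𝔣Φ : ∀ σ ∈ Φ, σ ≠ σ₁ → 𝔣 σ = 0)
    (h𝔣σ₁c : 𝔣 (conjEmb σ₁) = (n : ℤ) - 1)
    (h𝔣Φc : ∀ σ ∈ Φ, σ ≠ σ₁ → 𝔣 (conjEmb σ) = (n : ℤ))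
    (T : Finset (F →+* ℂ)) (hT : T.Nonempty) (f : ℕ) (hf : T.card = f)
    (hTstab : ∀ σ : F →+* ℂ, σ ∈ T ↔ conjEmb σ ∈ T)
    (hσ₁T : σ₁ ∈ T) :
    (((T.filter fun σ => (n : ℤ) - (1 : ℤ) < 𝔣 σ).card : ℚ) / (f : ℚ)) = 1 / 2 - 1 / (f : ℚ) ∧
    (∀ j : ℕ, 1 < j → j < n →
      (((T.filter fun σ => (n : ℤ) - (j : ℤ) < 𝔣 σ).card : ℚ) / (f : ℚ)) = 1 / 2) ∧
    (((T.filter fun σ => (n : ℤ) - (n : ℤ) < 𝔣 σ).card : ℚ) / (f : ℚ)) = 1 / 2 + 1 / (f : ℚ) := by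
  classical
  have hconj : ∀ σ : F →+* ℂ, conjEmb σ ∈ Φ ↔ σ ∉ Φ := by
    intro σ
    rcases hΦ σ with ⟨h, h'⟩ | ⟨h, h'⟩ <;> simp [h, h']
  have hhalf := two_mul_card_filter_notMem_cmType hconj hTstab
  set A := T.filter (· ∉ Φ) with hA
  have hσ₁c : conjEmb σ₁ ∉ Φ := by simpa [hconj] using hσ₁
  have hmem : conjEmb σ₁ ∈ A := Finset.mem_filter.2 ⟨(hTstab σ₁).1 hσ₁T, hσ₁c⟩
  have hσ₁A : σ₁ ∉ A := fun h => (Finset.mem_filter.1 h).2 hσ₁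
  have hout : ∀ σ ∉ Φ, σ ≠ conjEmb σ₁ → 𝔣 σ = n := by
    intro σ hσ hne
    simpa using h𝔣Φc (conjEmb σ) ((hconj σ).2 hσ) (fun h => hne (by rw [← h, conjEmb_conjEmb]))
  have hval : ∀ σ, 𝔣 σ = if σ ∈ Φ then (if σ = σ₁ then 1 else 0)
      else if σ = conjEmb σ₁ then (n : ℤ) - 1 else n := by
    intro σ
    split_ifs with hσ heq heq
    · rw [heq, h𝔣σ₁]
    · exact h𝔣Φ σ hσ heq
    · rw [heq, h𝔣σ₁c]
    · exact hout σ hσ heq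
  clear htc hΦ hTstab hconj hout h𝔣Φ h𝔣Φc
  have hfirst : (T.filter fun σ => (n : ℤ) - (1 : ℤ) < 𝔣 σ) = A.erase (conjEmb σ₁) := by
    ext σ
    simp only [hA, Finset.mem_filter, Finset.mem_erase]
    grind
  have hmiddle : ∀ j : ℕ, 1 < j → j < n → (T.filter fun σ => (n : ℤ) - (j : ℤ) < 𝔣 σ) = A := by
    intro j hj hjn
    ext σ
    simp only [hA, Finset.mem_filter]
    grind
  have hlast : (T.filter fun σ => (n : ℤ) - (n : ℤ) < 𝔣 σ) = insert σ₁ A := by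
    ext σ
    simp only [hA, Finset.mem_filter, Finset.mem_insert]
    grind
  have hf0 : (f : ℚ) ≠ 0 := by
    rw [← hf]
    exact_mod_cast hT.card_ne_zero
  have hhalfQ : (A.card : ℚ) = f / 2 := by
    rw [← hf, ← hhalf]
    push_cast
    ring
  refine ⟨?_, fun j hj hjn => ?_, ?_⟩
  · rw [hfirst, Finset.cast_card_erase_of_mem hmem, hhalfQ]
    field_simp
  · rw [hmiddle j hj hjn, hhalfQ]
    field_simp
  · rw [hlast, Finset.card_insert_of_notMem hσ₁A]
    push_cast
    rw [hhalfQ]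
    field_simp
end

section
/- Let n ≥ 2 and f ≥ 2 be integers, and let μ be the multiset consisting of 1/2 − 1/f with multiplicity f, 1/2 with multiplicity (n−2)f, and 1/2 + 1/f with multiplicity f. Let ν be a multiset of nf rational numbers such that: ν lies on or above μ with the same endpoints; the multiplicity in ν of each of its elements is divisible by f; and ν is symmetric, i.e. for every rational λ the multiplicity of λ in ν equals the multiplicity of 1 − λ in ν. Then ν = μ if and only if the smallest element of ν equals 1/2 − 1/f. -/
/-- The sum of the `k` smallest elements (with multiplicity) of a finite multiset of
rationals.  In particular `partialSum ν 1` is the smallest element of a nonempty `ν`. -/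
noncomputable def partialSum (ν : Multiset ℚ) (k : ℕ) : ℚ :=
  ((ν.sort (· ≤ ·)).take k).sum

/-- `ν` lies on or above `μ` with the same endpoints: the two multisets have the same
cardinality, the same total sum, and for every `1 ≤ k ≤ card`, the sum of the `k` smallest
elements of `ν` is at least the sum of the `k` smallest elements of `μ`. -/
def LiesOnOrAbove (ν μ : Multiset ℚ) : Prop :=
  Multiset.card ν = Multiset.card μ ∧ ν.sum = μ.sum ∧
    ∀ k : ℕ, 1 ≤ k → k ≤ Multiset.card ν → partialSum μ k ≤ partialSum ν k

/-- Among the sublists of a given length of a sorted list, the initial one has least sum. -/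
theorem List.Pairwise.sum_take_length_le {l : List ℚ} (hl : l.Pairwise (· ≤ ·)) {t : List ℚ}
    (ht : t.Sublist l) : (l.take t.length).sum ≤ t.sum := by
  induction l generalizing t with
  | nil => simp [List.sublist_nil.mp ht]
  | cons a l ih =>
    rw [List.pairwise_cons] at hl
    cases t with
    | nil => simp
    | cons b t =>
      have hab : a ≤ b := by
        rcases List.mem_cons.mp (ht.subset List.mem_cons_self) with h | h
        · exact h.ge
        · exact hl.1 b h
      simpa using add_le_add hab (ih hl.2 ht.of_cons_cons)

/-- The sum of the `k` smallest elements is at most the sum of any `k` elements. -/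
theorem partialSum_card_le_sum {s ν : Multiset ℚ} (h : s ≤ ν) :
    partialSum ν (Multiset.card s) ≤ s.sum := by
  have hsub : (s.sort (· ≤ ·)).Sublist (ν.sort (· ≤ ·)) := by
    refine List.sublist_of_subperm_of_pairwise ?_ (s.pairwise_sort _) (ν.pairwise_sort _)
    rwa [← Multiset.coe_le, Multiset.sort_eq, Multiset.sort_eq]
  have := (ν.pairwise_sort (· ≤ ·)).sum_take_length_le hsub
  rwa [Multiset.length_sort, ← Multiset.sum_coe (s.sort _), Multiset.sort_eq] at this

/-- Partial sums of a multiset presented as a sorted list. -/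
theorem partialSum_coe_of_pairwise {l : List ℚ} (hl : l.Pairwise (· ≤ ·)) (k : ℕ) :
    partialSum (l : Multiset ℚ) k = (l.take k).sum := by
  have : (l : Multiset ℚ).sort (· ≤ ·) = l :=
    List.Perm.eq_of_pairwise' (Multiset.pairwise_sort _ _) hl
      (Multiset.coe_eq_coe.mp (Multiset.sort_eq _ _))
  rw [partialSum, this]

/-- Partial sums of a multiset with at most three distinct elements, as partial sums of a list. -/
theorem partialSum_replicate_add {a b c : ℚ} (hab : a ≤ b) (hbc : b ≤ c) (p q r k : ℕ) :
    partialSum (Multiset.replicate p a + Multiset.replicate q b + Multiset.replicate r c) k =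
      ((List.replicate p a ++ List.replicate q b ++ List.replicate r c).take k).sum := by
  rw [← partialSum_coe_of_pairwise]
  · simp only [← Multiset.coe_replicate, Multiset.coe_add]
  · simp only [List.pairwise_append, List.pairwise_replicate, List.mem_append,
      List.mem_replicate]
    grind

/-- The smallest element of a nonempty multiset belongs to it. -/
theorem partialSum_one_mem {ν : Multiset ℚ} (h : ν ≠ 0) : partialSum ν 1 ∈ ν := by
  rw [← Multiset.mem_sort (r := (· ≤ ·)), partialSum]
  cases hs : ν.sort (· ≤ ·) with
  | nil => exact absurd (by rw [← Multiset.sort_eq ν (· ≤ ·), hs]; rfl) h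
  | cons x l => simp

/-- Let `n ≥ 2`, `f ≥ 2`, and let `μ` consist of `1/2 − 1/f` with
multiplicity `f`, `1/2` with multiplicity `(n−2)f` and `1/2 + 1/f` with multiplicity `f`.
Let `ν` be a multiset of `nf` rationals lying on or above `μ` with the same endpoints, with
all multiplicities divisible by `f` and symmetric (`count λ = count (1 − λ)`).  Then `ν = μ`
iff the smallest element of `ν` equals `1/2 − 1/f`. -/
theorem stmt_8 (n f : ℕ) (hn : 2 ≤ n) (hf : 2 ≤ f) (μ ν : Multiset ℚ)
    (hμ : μ = Multiset.replicate f (1/2 - 1/(f : ℚ)) +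
      Multiset.replicate ((n - 2) * f) (1/2) +
      Multiset.replicate f (1/2 + 1/(f : ℚ)))
    (hcard : Multiset.card ν = n * f)
    (habove : LiesOnOrAbove ν μ)
    (hdiv : ∀ x ∈ ν, f ∣ ν.count x)
    (hsymm : ∀ lam : ℚ, ν.count lam = ν.count (1 - lam)) :
    ν = μ ↔ partialSum ν 1 = 1/2 - 1/(f : ℚ) := by
  have hfpos : (0 : ℚ) < 1 / f := by positivity
  set a : ℚ := 1 / 2 - 1 / f with ha
  have hc : (1 / 2 + 1 / f : ℚ) = 1 - a := by rw [ha]; ring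
  rw [hc] at hμ
  have ha2 : a < 1 / 2 := by linarith
  have hps := partialSum_replicate_add (c := 1 - a) ha2.le (by linarith) f ((n - 2) * f) f
  rw [← hμ] at hps
  constructor
  · rintro rfl
    obtain ⟨m, rfl⟩ : ∃ m, f = m + 1 := ⟨f - 1, by omega⟩
    rw [hps]
    simp [List.replicate_succ]
  intro hmin
  have hν0 : ν ≠ 0 := by
    rintro rfl
    have : 0 < n * f := by positivity
    simp at hcard
    omega
  have hmem : a ∈ ν := hmin ▸ partialSum_one_mem hν0
  have hcount : f ≤ ν.count a := Nat.le_of_dvd (Multiset.count_pos.mpr hmem) (hdiv a hmem)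
  have hle : Multiset.replicate f a + Multiset.replicate f (1 - a) ≤ ν := by
    rw [Multiset.le_iff_count]
    intro x
    have := hsymm a
    simp only [Multiset.count_add, Multiset.count_replicate]
    grind
  obtain ⟨ρ, rfl⟩ := Multiset.le_iff_exists_add.mp hle
  have hcardρ : Multiset.card ρ = (n - 2) * f := by
    obtain ⟨m, rfl⟩ : ∃ m, n = m + 2 := ⟨n - 2, by omega⟩
    simp at hcard ⊢
    linarith
  have hρsymm : ∀ x ∈ ρ, 1 - x ∈ ρ := by
    intro x hx
    have := hsymm x
    rw [← Multiset.count_pos] at hx ⊢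
    simp only [Multiset.count_add, Multiset.count_replicate] at this
    grind
  have hρge : ∀ x ∈ ρ, 1 / 2 ≤ x := by
    intro x hx
    have hpos : 0 < (n - 2) * f := hcardρ ▸ Multiset.card_pos_iff_exists_mem.mpr ⟨x, hx⟩
    have hsub : Multiset.replicate f a + {x} ≤
        Multiset.replicate f a + Multiset.replicate f (1 - a) + ρ := by
      rw [add_assoc]
      gcongr
      exact (Multiset.singleton_le.mpr hx).trans (Multiset.le_add_left _ _)
    have h1 := partialSum_card_le_sum hsub
    have h2 := habove.2.2 (f + 1) (by omega) (by simpa using Multiset.card_le_card hsub)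
    obtain ⟨m, hm⟩ : ∃ m, (n - 2) * f = m + 1 := ⟨(n - 2) * f - 1, by omega⟩
    rw [hps, hm] at h2
    simp [List.take_append, List.replicate_succ] at h1 h2
    linarith
  have hρ : ρ = Multiset.replicate ((n - 2) * f) (1 / 2) := by
    refine Multiset.eq_replicate.mpr ⟨hcardρ, fun x hx => le_antisymm ?_ (hρge x hx)⟩
    linarith [hρge _ (hρsymm x hx)]
  rw [hμ, hρ]
  abel
end

section
/- Let n ≥ 1, f ≥ 1, and a be integers with 1 ≤ a ≤ f, and let μ be the multiset consisting of (a−1)/f with multiplicity f and a/f with multiplicity (n−1)f. Let ν be a multiset of nf rational numbers such that ν lies on or above μ with the same endpoints and the multiplicity in ν of each of its elements is divisible by f. Then ν = μ if and only if the smallest element of ν equals (a−1)/f. -/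
/-- The first partial sum of a nonempty multiset is its least element. -/
theorem partialSum_one_isLeast {ν : Multiset ℚ} (hν : ν ≠ 0) :
    IsLeast {x | x ∈ ν} (partialSum ν 1) := by
  have hmem : ∀ x, x ∈ ν.sort (· ≤ ·) ↔ x ∈ ν := fun x => Multiset.mem_sort _
  have hsort : (ν.sort (· ≤ ·)).Pairwise (· ≤ ·) := Multiset.pairwise_sort _ _
  unfold partialSum
  cases hl : ν.sort (· ≤ ·) with
  | nil =>
    refine absurd ?_ hν
    rw [← Multiset.sort_eq ν (· ≤ ·), hl]
    rfl
  | cons b l =>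
    rw [hl] at hmem hsort
    simp only [List.take_succ_cons, List.take_zero, List.sum_cons, List.sum_nil, add_zero]
    refine ⟨(hmem b).1 (by simp), fun x hx => ?_⟩
    rcases List.mem_cons.1 ((hmem x).2 hx) with rfl | h
    · exact le_rfl
    · exact (List.pairwise_cons.1 hsort).1 x h

/-- The partial sum omitting one element differs from the total sum by the greatest element. -/
theorem exists_isGreatest_partialSum_add {ν : Multiset ℚ} {k : ℕ}
    (hν : Multiset.card ν = k + 1) :
    ∃ m, IsGreatest {x | x ∈ ν} m ∧ partialSum ν k + m = ν.sum := by
  have hmem : ∀ x, x ∈ ν.sort (· ≤ ·) ↔ x ∈ ν := fun x => Multiset.mem_sort _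
  have hsort : (ν.sort (· ≤ ·)).Pairwise (· ≤ ·) := Multiset.pairwise_sort _ _
  have hlen : (ν.sort (· ≤ ·)).length = k + 1 := by rw [Multiset.length_sort, hν]
  have hsum : (ν.sort (· ≤ ·)).sum = ν.sum := by
    rw [← Multiset.sum_coe, Multiset.sort_eq]
  unfold partialSum
  rcases List.eq_nil_or_concat (ν.sort (· ≤ ·)) with hl | ⟨l, m, hl⟩
  · simp [hl] at hlen
  · rw [List.concat_eq_append] at hl
    rw [hl] at hmem hsort hlen hsum ⊢
    have hk : l.length = k := by simpa using hlen
    refine ⟨m, ⟨(hmem m).1 (by simp), fun x hx => ?_⟩, ?_⟩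
    · rcases List.mem_append.1 ((hmem x).2 hx) with h | h
      · exact (List.pairwise_append.1 hsort).2.2 x h m (by simp)
      · exact (List.mem_singleton.1 h).le
    · rw [← hsum, ← hk]
      simp

/-- A multiset bounded above by `c` whose sum is `card • c` is constant. -/
theorem Multiset.eq_replicate_of_le_of_sum_eq {c : ℚ} (s : Multiset ℚ)
    (hle : ∀ x ∈ s, x ≤ c) (hsum : s.sum = Multiset.card s • c) :
    s = Multiset.replicate (Multiset.card s) c := by
  refine Multiset.eq_replicate_card.2 fun x hx => ?_
  obtain ⟨t, rfl⟩ := Multiset.exists_cons_of_mem hx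
  have ht : t.sum ≤ Multiset.card t • c :=
    Multiset.sum_le_card_nsmul t c fun y hy => hle y (Multiset.mem_cons_of_mem hy)
  have hxc := hle x hx
  rw [Multiset.sum_cons, Multiset.card_cons, succ_nsmul] at hsum
  linarith

/-- The greatest element can only decrease when passing to a multiset lying on or above. -/
theorem LiesOnOrAbove.le_of_forall_le {ν μ : Multiset ℚ} (h : LiesOnOrAbove ν μ) {c : ℚ}
    (hμ : ∀ x ∈ μ, x ≤ c) : ∀ x ∈ ν, x ≤ c := by
  intro x hx
  obtain ⟨hcard, hsum, hpart⟩ := h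
  obtain ⟨k, hk⟩ := Nat.exists_eq_succ_of_ne_zero
    (Multiset.card_pos_iff_exists_mem.2 ⟨x, hx⟩).ne'
  obtain ⟨m, hm, hms⟩ := exists_isGreatest_partialSum_add hk
  obtain ⟨m', hm', hms'⟩ := exists_isGreatest_partialSum_add (hcard.symm.trans hk)
  have hp : partialSum μ k ≤ partialSum ν k := by
    rcases Nat.eq_zero_or_pos k with rfl | hpos
    · simp [partialSum]
    · exact hpart k hpos (by omega)
  have hxm : x ≤ m := hm.2 hx
  have hmc : m' ≤ c := hμ m' hm'.1
  linarith

/-- Let `n, f ≥ 1`, `1 ≤ a ≤ f`, and let `μ` consist of `(a−1)/f` with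
multiplicity `f` and `a/f` with multiplicity `(n−1)f`.  Let `ν` be a multiset of `nf`
rationals lying on or above `μ` with the same endpoints, with all multiplicities divisible
by `f`.  Then `ν = μ` iff the smallest element of `ν` equals `(a−1)/f`. -/
theorem stmt_9 (n f a : ℕ) (hn : 1 ≤ n) (hf : 1 ≤ f) (ha : 1 ≤ a) (haf : a ≤ f)
    (μ ν : Multiset ℚ)
    (hμ : μ = Multiset.replicate f (((a : ℚ) - 1) / (f : ℚ)) +
      Multiset.replicate ((n - 1) * f) ((a : ℚ) / (f : ℚ)))
    (hcard : Multiset.card ν = n * f)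
    (habove : LiesOnOrAbove ν μ)
    (hdiv : ∀ x ∈ ν, f ∣ ν.count x) :
    ν = μ ↔ partialSum ν 1 = ((a : ℚ) - 1) / (f : ℚ) := by
  have hf0 : (0 : ℚ) < f := by exact_mod_cast hf
  have hbc : ((a : ℚ) - 1) / f ≤ (a : ℚ) / f := by gcongr; linarith
  generalize ((a : ℚ) - 1) / f = b at *
  generalize (a : ℚ) / f = c at *
  have hν0 : ν ≠ 0 := by
    rintro rfl
    have : 0 < n * f := Nat.mul_pos hn hf
    simp at hcard
    omega
  have hleast := partialSum_one_isLeast hν0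
  constructor
  · intro h
    have hb : b ∈ ν := by
      rw [h, hμ, Multiset.mem_add]
      exact Or.inl (Multiset.mem_replicate.2 ⟨by omega, rfl⟩)
    refine hleast.unique ⟨hb, fun x hx => ?_⟩
    rw [Set.mem_ofPred_eq, h, hμ, Multiset.mem_add] at hx
    rcases hx with hx | hx
    · exact (Multiset.eq_of_mem_replicate hx).ge
    · exact hbc.trans (Multiset.eq_of_mem_replicate hx).ge
  · intro h
    rw [h] at hleast
    have hle : ∀ x ∈ ν, x ≤ c := habove.le_of_forall_le fun x hx => by
      rw [hμ, Multiset.mem_add] at hx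
      rcases hx with hx | hx
      · exact (Multiset.eq_of_mem_replicate hx).le.trans hbc
      · exact (Multiset.eq_of_mem_replicate hx).le
    have hcount : f ≤ ν.count b :=
      Nat.le_of_dvd (Multiset.count_pos.2 hleast.1) (hdiv b hleast.1)
    obtain ⟨ρ, hρ⟩ := Multiset.le_iff_exists_add.1 (Multiset.le_count_iff_replicate_le.1 hcount)
    have hcards : Multiset.card ρ = (n - 1) * f := by
      have hνμ := habove.1
      rw [hρ, hμ] at hνμ
      simpa using hνμ
    have hsum : ρ.sum = Multiset.card ρ • c := by
      have hνμ := habove.2.1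
      rw [hρ, hμ, Multiset.sum_add, Multiset.sum_add, Multiset.sum_replicate _ c] at hνμ
      rw [hcards]
      exact add_left_cancel hνμ
    have hρc := ρ.eq_replicate_of_le_of_sum_eq
      (fun x hx => hle x (by rw [hρ]; exact Multiset.mem_add.2 (Or.inr hx))) hsum
    rw [hρ, hμ, hρc, hcards]
end

section
/- The set of positive integers n for which the ℚ-linear span of the orbit {τ·𝔣_n : τ a field automorphism of ℂ}, inside the ℚ-vector space of ℚ-valued functions on the set of complex embeddings of F, has dimension different from d + 1 is finite. In other words, for all but finitely many relative dimensions n, the span of the Galois translates of the simple signature is (d+1)-dimensional. -/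
open Cardinal in
/-- Two embeddings of a countable field into uncountable algebraically closed fields of the same
cardinality differ by an isomorphism. -/
theorem exists_ringEquiv_comp_eq_of_isAlgClosed {R K L : Type*} [Field R] [Countable R] [Field K]
    [Field L] [IsAlgClosed K] [IsAlgClosed L] (hK : ℵ₀ < #K) (hKL : Nonempty (K ≃ L))
    (f : R →+* K) (g : R →+* L) : ∃ e : K ≃+* L, (e : K →+* L).comp f = g := by
  algebraize [f, g]
  obtain ⟨s, hs⟩ := exists_isTranscendenceBasis R K
  obtain ⟨t, ht⟩ := exists_isTranscendenceBasis R L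
  have hR : #R ≤ ℵ₀ := mk_le_aleph0
  have hL : ℵ₀ < #L := by
    rwa [← aleph0_lt_lift, ← lift_mk_eq'.2 hKL, aleph0_lt_lift]
  have hst : Nonempty (s ≃ t) := by
    obtain ⟨φ⟩ := hKL
    have hsK := IsAlgClosed.cardinal_eq_cardinal_transcendence_basis_of_aleph0_lt _ hs hR hK
    have htL := IsAlgClosed.cardinal_eq_cardinal_transcendence_basis_of_aleph0_lt _ ht hR hL
    obtain ⟨a⟩ := Cardinal.eq.1 (lift_injective hsK)
    obtain ⟨b⟩ := Cardinal.eq.1 (lift_injective htL)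
    exact ⟨a.symm.trans (φ.trans b)⟩
  obtain ⟨e⟩ := hst
  have := IsAlgClosed.isAlgClosure_of_transcendence_basis _ hs
  have := IsAlgClosed.isAlgClosure_of_transcendence_basis _ ht
  let ψ := (hs.1.aevalEquiv.symm.trans (MvPolynomial.renameEquiv R e)).trans ht.1.aevalEquiv
  refine ⟨IsAlgClosure.equivOfEquiv K L ψ.toRingEquiv, RingHom.ext fun x => ?_⟩
  have h := IsAlgClosure.equivOfEquiv_algebraMap K L ψ.toRingEquiv (algebraMap R _ x)
  rw [← IsScalarTower.algebraMap_apply] at h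
  refine h.trans ?_
  change algebraMap _ L (ψ (algebraMap R _ x)) = _
  rw [ψ.commutes, ← IsScalarTower.algebraMap_apply]
  rfl

/-- For all but finitely many `n`, the matrix `1 - (n / 2) A` is invertible. -/
theorem Matrix.finite_setOf_det_one_sub_smul_eq_zero {ι : Type*} [Fintype ι] [DecidableEq ι]
    (A : Matrix ι ι ℚ) : {n : ℕ | (1 - ((n : ℚ) / 2) • A).det = 0}.Finite := by
  have hp : A.charpolyRev ≠ 0 := fun h => by
    simpa [h] using A.eval_charpolyRev
  refine Set.Finite.of_finite_image (f := fun n : ℕ => (n : ℚ) / 2)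
    ((Polynomial.finite_setOfPred_isRoot hp).subset ?_) fun a _ b _ h => by simpa using h
  rintro _ ⟨n, hn, rfl⟩
  refine Eq.trans ?_ (Set.mem_ofPred_eq ▸ hn)
  rw [Matrix.charpolyRev, ← Polynomial.coe_evalRingHom, RingHom.map_det]
  congr 1
  ext i j
  by_cases h : i = j <;> simp [h] <;> ring

section Signature

variable {E : Type*} {s : E → E} {Φ : Finset E}

theorem card_eq_two_mul_of_xor [Fintype E] (hs : Function.Involutive s)
    (hΦ : ∀ x, Xor (x ∈ Φ) (s x ∈ Φ)) : Fintype.card E = 2 * Φ.card := by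
  classical
  have h : Φᶜ = Φ.image s := by
    ext x
    rw [Finset.mem_compl, Finset.mem_image]
    constructor
    · intro hx
      exact ⟨s x, ((hΦ x).resolve_left fun h => hx h.1).1, hs x⟩
    · rintro ⟨y, hy, rfl⟩ hx
      rcases hΦ y with h | h
      · exact h.2 hx
      · exact h.2 hy
  have h' := Finset.card_add_card_compl Φ
  rw [h, Finset.card_image_of_injective _ hs.injective] at h'
  omega

/-- Functions whose sum with their `s`-translate is constant are determined by that constant and
by their values on `Φ`. -/
theorem finrank_le_card_add_one (hΦ : ∀ x, Xor (x ∈ Φ) (s x ∈ Φ)) (x₁ : E) (W : Submodule ℚ (E → ℚ))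
    (hW : ∀ f ∈ W, ∀ x, f x + f (s x) = f x₁ + f (s x₁)) :
    Module.finrank ℚ W ≤ Φ.card + 1 := by
  let ev : W →ₗ[ℚ] (Φ → ℚ) × ℚ :=
    { toFun := fun f => (fun i => f.1 i, f.1 x₁ + f.1 (s x₁))
      map_add' := fun f g => by
        ext <;> simp
        ring
      map_smul' := fun r f => by
        ext <;> simp
        ring }
  have hinj : Function.Injective ev := by
    rw [← LinearMap.ker_eq_bot, LinearMap.ker_eq_bot']
    intro f hf
    have h₁ : ∀ x ∈ Φ, f.1 x = 0 := fun x hx => congrFun (congrArg Prod.fst hf) ⟨x, hx⟩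
    have h₂ : f.1 x₁ + f.1 (s x₁) = 0 := congrArg Prod.snd hf
    ext x
    rcases hΦ x with h | h
    · exact h₁ x h.1
    · have := hW f.1 f.2 x
      rw [h₁ _ h.1, h₂, add_zero] at this
      exact this
  simpa using LinearMap.finrank_le_finrank_of_injective hinj

/-- The values of a simple signature of relative dimension `n` with respect to `Φ` and `x₁`,
where `s` plays the role of complex conjugation. -/
structure IsSimpleSignature (s : E → E) (Φ : Finset E) (x₁ : E) (n : ℕ) (f : E → ℚ) : Prop where
  apply_base : f x₁ = 1
  apply_mem : ∀ x ∈ Φ, x ≠ x₁ → f x = 0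
  apply_conj_base : f (s x₁) = n - 1
  apply_conj_mem : ∀ x ∈ Φ, x ≠ x₁ → f (s x) = n

theorem IsSimpleSignature.add_conj {x₁ : E} {n : ℕ} {f : E → ℚ}
    (hf : IsSimpleSignature s Φ x₁ n f) (hs : Function.Involutive s)
    (hΦ : ∀ x, Xor (x ∈ Φ) (s x ∈ Φ)) (x : E) : f x + f (s x) = n := by
  have key : ∀ y ∈ Φ, f y + f (s y) = n := fun y hy => by
    by_cases h : y = x₁
    · rw [h, hf.apply_base, hf.apply_conj_base]; ring
    · rw [hf.apply_mem y hy h, hf.apply_conj_mem y hy h, zero_add]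
  rcases hΦ x with h | h
  · exact key x h.1
  · simpa [hs x, add_comm] using key (s x) h.1

/-- For a family `T` of permutations commuting with the conjugation `s`, stable under composition
with `s` and moving every point to `x₁`, the translates of the simple signature of relative
dimension `n` span a space of dimension `#Φ + 1` for all but finitely many `n`. -/
theorem finite_setOf_finrank_span_translates_ne [Finite E] (hs : Function.Involutive s)
    (hΦ : ∀ x, Xor (x ∈ Φ) (s x ∈ Φ)) {x₁ : E} (hx₁ : x₁ ∈ Φ) {𝔣 : ℕ → E → ℚ}
    (h𝔣 : ∀ n, IsSimpleSignature s Φ x₁ n (𝔣 n)) {G : Type*}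
    (T : G → Equiv.Perm E) (hcomm : ∀ g x, T g (s x) = s (T g x))
    (htrans : ∀ x, ∃ g, T g x = x₁) (hconj : ∀ g, ∃ g', ∀ x, T g' x = s (T g x)) :
    {n : ℕ | 1 ≤ n ∧ Module.finrank ℚ
      (Submodule.span ℚ {g : E → ℚ | ∃ u, g = fun x => 𝔣 n (T u x)}) ≠ Φ.card + 1}.Finite := by
  classical
  choose t ht using htrans
  let A : Matrix Φ Φ ℚ := fun i j => if T (t i) j ∈ Φ then 1 else -1
  refine (A.finite_setOf_det_one_sub_smul_eq_zero).subset ?_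
  rintro n ⟨hn, hne⟩
  by_contra hdet
  apply hne
  have hsum := (h𝔣 n).add_conj hs hΦ
  have hn' : (n : ℚ) ≠ 0 := by positivity
  set W := Submodule.span ℚ {g : E → ℚ | ∃ u, g = fun x => 𝔣 n (T u x)}
  have hmem : ∀ u, (fun x => 𝔣 n (T u x)) ∈ W := fun u => Submodule.subset_span ⟨u, rfl⟩
  refine le_antisymm (finrank_le_card_add_one hΦ x₁ W fun f hf x => ?_) ?_
  · induction hf using Submodule.span_induction with
    | mem f hf =>
      obtain ⟨u, rfl⟩ := hf
      simp only [hcomm, hsum]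
    | zero => simp
    | add f g _ _ hf hg => simp only [Pi.add_apply]; linarith
    | smul r f _ hf => simp only [Pi.smul_apply, smul_eq_mul, ← mul_add, hf]
  have hone : (1 : E → ℚ) ∈ W := by
    obtain ⟨u, hus⟩ := hconj (t x₁)
    have h := W.smul_mem (n : ℚ)⁻¹ (W.add_mem (hmem (t x₁)) (hmem u))
    convert h using 1
    ext x
    simp [hus, hsum, hn']
  have hentry : ∀ i j : Φ,
      𝔣 n (T (t i) j) - n / 2 = (1 - ((n : ℚ) / 2) • A) i j := by
    intro i j
    rw [Matrix.sub_apply, Matrix.smul_apply, Matrix.one_apply, smul_eq_mul]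
    have hiff : T (t i) j = x₁ ↔ i = j := by
      rw [← ht i, (T (t i)).apply_eq_iff_eq, Subtype.ext_iff, eq_comm]
    by_cases hmemΦ : T (t i) j ∈ Φ
    · by_cases hij : i = j
      · subst hij
        simp [A, ht, (h𝔣 n).apply_base, hx₁]
      · have := (h𝔣 n).apply_mem _ hmemΦ (mt hiff.1 hij)
        simp [A, hmemΦ, hij, this]
    · have hij : i ≠ j := fun h => hmemΦ (hiff.2 h ▸ hx₁)
      have hsΦ : s (T (t i) j) ∈ Φ := ((hΦ (T (t i) j)).resolve_left fun h => hmemΦ h.1).1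
      have hne₁ : s (T (t i) j) ≠ x₁ := fun h => by
        rw [← hcomm, ← ht i, (T (t i)).apply_eq_iff_eq] at h
        rcases hΦ j with h' | h'
        · exact h'.2 (h ▸ i.2)
        · exact h'.2 j.2
      have := (h𝔣 n).apply_conj_mem _ hsΦ hne₁
      rw [hs] at this
      simp [A, hmemΦ, hij, this]
      ring
  let v : Option Φ → W := fun o =>
    o.elim ⟨1, hone⟩ fun i => ⟨fun x => 𝔣 n (T (t i) x), hmem (t i)⟩
  have hv : LinearIndependent ℚ v := by
    rw [Fintype.linearIndependent_iff]
    intro b hb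
    have hval : ∀ x, b none + ∑ i : Φ, b (some i) * 𝔣 n (T (t i) x) = 0 := fun x => by
      have := congrFun (congrArg Subtype.val hb) x
      simpa [Fintype.sum_option, v] using this
    have hmean : b none + ∑ i : Φ, b (some i) * (n / 2 : ℚ) = 0 := by
      have h₁ := hval x₁
      have h₂ := hval (s x₁)
      have h₃ : ∀ i : Φ, b (some i) * (n / 2 : ℚ) =
          (b (some i) * 𝔣 n (T (t i) x₁) + b (some i) * 𝔣 n (T (t i) (s x₁))) / 2 := fun i => by
        rw [← mul_add, hcomm, hsum]; ring
      simp only [h₃, ← Finset.sum_div, Finset.sum_add_distrib]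
      linarith
    have hvec : Matrix.vecMul (fun i => b (some i)) (1 - ((n : ℚ) / 2) • A) = 0 := by
      ext j
      simp only [Matrix.vecMul, dotProduct, ← hentry, mul_sub, Finset.sum_sub_distrib,
        Pi.zero_apply]
      linarith [hval j]
    have hzero := Matrix.eq_zero_of_vecMul_eq_zero hdet hvec
    have hsome : ∀ i, b (some i) = 0 := congrFun hzero
    rintro (_ | i)
    · simpa [hsome] using hmean
    · exact hsome i
  simpa using hv.fintype_card_le_finrank

end Signature

/-- Let `F` be a CM field of degree `2d` over `ℚ` with complex conjugation
`c`, `Φ` a CM type of `F`, `σ₁ ∈ Φ`, and for each `n ≥ 1` let `𝔣 n` be the simple signature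
of relative dimension `n`, viewed as a `ℚ`-valued function on the complex embeddings of `F`.
Field automorphisms `τ` of `ℂ` act on such functions via `(τ·𝔣)(σ) = 𝔣(τ⁻¹ ∘ σ)`.  Then the
set of positive integers `n` for which the `ℚ`-linear span of the orbit `{τ·𝔣_n}` has
dimension different from `d + 1` is finite. -/
theorem stmt_10 (F : Type*) [Field F] [NumberField F]
    (d : ℕ) (hd : 1 ≤ d) (hdeg : Module.finrank ℚ F = 2 * d)
    (c : F ≃+* F)
    (hc : ∀ σ : F →+* ℂ, σ.comp (c : F →+* F) = (starRingEnd ℂ).comp σ)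
    (htc : ∀ σ : F →+* ℂ, (starRingEnd ℂ).comp σ ≠ σ)
    (Φ : Finset (F →+* ℂ))
    (hΦ : ∀ σ : F →+* ℂ, Xor' (σ ∈ Φ) ((starRingEnd ℂ).comp σ ∈ Φ))
    (σ₁ : F →+* ℂ) (hσ₁ : σ₁ ∈ Φ)
    (𝔣 : ℕ → (F →+* ℂ) → ℚ)
    (h𝔣σ₁ : ∀ n : ℕ, 𝔣 n σ₁ = 1)
    (h𝔣Φ : ∀ n : ℕ, ∀ σ ∈ Φ, σ ≠ σ₁ → 𝔣 n σ = 0)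
    (h𝔣σ₁c : ∀ n : ℕ, 𝔣 n ((starRingEnd ℂ).comp σ₁) = (n : ℚ) - 1)
    (h𝔣Φc : ∀ n : ℕ, ∀ σ ∈ Φ, σ ≠ σ₁ → 𝔣 n ((starRingEnd ℂ).comp σ) = (n : ℚ)) :
    {n : ℕ | 1 ≤ n ∧
      Module.finrank ℚ
        (Submodule.span ℚ
          {g : (F →+* ℂ) → ℚ | ∃ τ : ℂ ≃+* ℂ,
            g = fun σ => 𝔣 n ((τ.symm : ℂ →+* ℂ).comp σ)}) ≠ d + 1}.Finite := by
  have hcard := NumberField.Embeddings.card F ℂ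
  have hs : Function.Involutive fun σ : F →+* ℂ => (starRingEnd ℂ).comp σ := fun σ => by
    ext; simp
  have hΦcard : Φ.card = d := by
    have := card_eq_two_mul_of_xor hs hΦ
    omega
  have hcomm : ∀ (τ : ℂ →+* ℂ) (σ : F →+* ℂ),
      τ.comp ((starRingEnd ℂ).comp σ) = (starRingEnd ℂ).comp (τ.comp σ) := fun τ σ => by
    rw [← hc, ← hc, RingHom.comp_assoc]
  let P : (ℂ ≃+* ℂ) → Equiv.Perm (F →+* ℂ) := fun τ =>
    { toFun := fun σ => (τ.symm : ℂ →+* ℂ).comp σ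
      invFun := fun σ => (τ : ℂ →+* ℂ).comp σ
      left_inv := fun σ => by ext; simp
      right_inv := fun σ => by ext; simp }
  have key := finite_setOf_finrank_span_translates_ne hs hΦ hσ₁ (𝔣 := 𝔣)
    (fun n => ⟨h𝔣σ₁ n, h𝔣Φ n, h𝔣σ₁c n, h𝔣Φc n⟩) P ?_ ?_ ?_
  · rw [hΦcard] at key
    exact key
  · exact fun τ σ => hcomm _ σ
  · intro σ
    have : Countable F := (Module.finBasis ℚ F).equivFun.toEquiv.countable_iff.2 inferInstance
    obtain ⟨e, he⟩ := exists_ringEquiv_comp_eq_of_isAlgClosed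
      (by rw [Cardinal.mk_complex]; exact Cardinal.aleph0_lt_continuum) ⟨Equiv.refl ℂ⟩ σ σ₁
    exact ⟨e.symm, he⟩
  · exact fun τ => ⟨(starRingAut (R := ℂ)).trans τ, fun σ => rfl⟩
end
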